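/- Let Γ be a connected multigraph and let (a_e)_{e∈E(Γ)} be nonnegative real numbers, not all zero. Then ψ(Γ) evaluated at (a_e) equals zero if and only if the subgraph Γ_μ with edge set μ = {e : a_e = 0} has h1(Γ_μ) > 0 (i.e., contains a cycle). In particular ψ(Γ)(a) > 0 whenever all a_e > 0, so the graph hypersurface X_Γ : ψ(Γ) = 0 has no real points with all coordinates positive, and the intersection of X_Γ with the set of points with all coordinates ≥ 0 is the union of the nonnegative loci of the coordinate linear spaces L_μ with h1(Γ_μ) > 0. -/

import Mathlib

open scoped Classical

/-- A multigraph: finite sets of vertices and edges, where each edge is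
assigned an unordered pair of (possibly equal) endpoints. -/
structure Multigraph where
  V : Type
  E : Type
  finV : Finite V
  finE : Finite E
  ends : E → Sym2 V

attribute [instance] Multigraph.finV Multigraph.finE

namespace Multigraph

variable (G : Multigraph)

/-- `v` and `w` are joined by some edge belonging to `μ`. -/
def Step (μ : Set G.E) (v w : G.V) : Prop :=
  ∃ e ∈ μ, G.ends e = s(v, w)

/-- Connectivity with respect to the edge set `μ`, as a setoid on all vertices. -/
def connSetoid (μ : Set G.E) : Setoid G.V :=
  Relation.EqvGen.setoid (G.Step μ)

/-- The number of connected components of the spanning subgraph `(V(G), μ)`. -/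
noncomputable def h0 (μ : Set G.E) : ℕ :=
  Nat.card (Quotient (G.connSetoid μ))

/-- The first Betti number `h1 = |E| − |V| + h0` of the subgraph with edge set `μ`.
(Isolated vertices contribute equally to `|V|` and to `h0`, so this agrees with
the first Betti number of the subgraph whose vertices are the endpoints of the
edges in `μ`.) -/
noncomputable def h1 (μ : Set G.E) : ℤ :=
  (Nat.card μ : ℤ) - (Nat.card G.V : ℤ) + (G.h0 μ : ℤ)

/-- A subgraph (identified with its edge set) is core (1PI): removing any one of
its edges lowers `h1`. -/
def IsCore (μ : Set G.E) : Prop :=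
  ∀ e ∈ μ, G.h1 (μ \ {e}) < G.h1 μ

/-- The multigraph is connected. -/
def Connected : Prop := G.h0 Set.univ = 1

/-- The contraction `Γ//γ`: each connected component of `γ` is contracted to a
single vertex and the edges of `γ` are deleted. -/
def contract (γ : Set G.E) : Multigraph where
  V := Quotient (G.connSetoid γ)
  E := {e : G.E // e ∉ γ}
  finV := Quotient.finite _
  finE := Subtype.finite
  ends e := (G.ends e.1).map (Quotient.mk (G.connSetoid γ))

/-- The subgraph with edge set `γ`, as a multigraph in its own right. -/
def restrict (γ : Set G.E) : Multigraph where
  V := G.V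
  E := γ
  finV := G.finV
  finE := Subtype.finite
  ends e := G.ends e.1

/-- `F` is a spanning forest: it is acyclic and consists of one spanning tree of
each connected component (equivalently, it induces the same connectivity
relation as the full edge set). -/
def IsSpanningForest (F : Set G.E) : Prop :=
  G.h1 F = 0 ∧ G.connSetoid F = G.connSetoid Set.univ

/-- The first Kirchhoff–Symanzik (graph) polynomial
`ψ(Γ) = Σ_F Π_{e ∉ F} A_e`, the sum over spanning forests. -/
noncomputable def kirchhoff : MvPolynomial G.E ℤ :=
  ∑ᶠ F ∈ {F : Set G.E | G.IsSpanningForest F}, ∏ᶠ e ∈ Fᶜ, MvPolynomial.X e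

/-- Euclidean dot product on `ℝ^D`. -/
noncomputable def dot {D : ℕ} (x y : Fin D → ℝ) : ℝ := ∑ i, x i * y i

/-- The total momentum entering the connected component `c` of `(V(G), F)`. -/
noncomputable def momentumOf {D : ℕ} (q : G.V → Fin D → ℝ) (F : Set G.E)
    (c : Quotient (G.connSetoid F)) : Fin D → ℝ :=
  ∑ᶠ v ∈ {v : G.V | Quotient.mk (G.connSetoid F) v = c}, q v

/-- The second Kirchhoff–Symanzik polynomial
`φ(Γ) = Σ_{(T₁,T₂)} (Q(T₁)·Q(T₂)) Π_{e ∉ T₁∪T₂} A_e`, the sum over spanning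
2-forests, i.e. acyclic edge sets `F` with exactly two connected components
`T₁, T₂` (jointly covering all vertices); `Q(T_i)` is the sum of the momenta
over the vertices of `T_i`, and `Q(T₁)·Q(T₂)` is computed symmetrically via
`Q(T₁)·Q(T₂) = ((Q(T₁)+Q(T₂))² − Q(T₁)² − Q(T₂)²)/2`. -/
noncomputable def symanzik2 (D : ℕ) (q : G.V → Fin D → ℝ) : MvPolynomial G.E ℝ :=
  ∑ᶠ F ∈ {F : Set G.E | G.h1 F = 0 ∧ G.h0 F = 2},
    MvPolynomial.C
      ((dot (∑ᶠ v, q v) (∑ᶠ v, q v) -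
          ∑ᶠ c : Quotient (G.connSetoid F), dot (G.momentumOf q F c) (G.momentumOf q F c)) / 2) *
      ∏ᶠ e ∈ Fᶜ, MvPolynomial.X e

/-- External momenta pass to the contraction `Γ//γ` by assigning to each vertex
(i.e. each connected component of `γ`, or untouched vertex) the sum of the
momenta of the vertices identified to it. -/
noncomputable def contractMomenta (γ : Set G.E) {D : ℕ} (q : G.V → Fin D → ℝ) :
    (G.contract γ).V → Fin D → ℝ :=
  fun c => ∑ᶠ v ∈ {v : G.V | Quotient.mk (G.connSetoid γ) v = c}, q v

/-- A flag of core subgraphs of the subgraph `γ`: a chain (under inclusion) of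
nonempty core subgraphs of `γ`, having `γ` itself as its largest member.  We
encode a flag as its set of members. -/
def IsCoreFlagIn (γ : Set G.E) (F : Set (Set G.E)) : Prop :=
  γ ∈ F ∧ ∅ ∉ F ∧ (∀ δ ∈ F, δ ⊆ γ ∧ G.IsCore δ) ∧ IsChain (· ⊆ ·) F

/-- A maximal flag of core subgraphs of `γ`: one admitting no refinement. -/
def IsMaximalCoreFlagIn (γ : Set G.E) (F : Set (Set G.E)) : Prop :=
  G.IsCoreFlagIn γ F ∧ ∀ F' : Set (Set G.E), G.IsCoreFlagIn γ F' → F ⊆ F' → F' = F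

/-- A flag of core subgraphs of `Γ`. -/
def IsCoreFlag (F : Set (Set G.E)) : Prop := G.IsCoreFlagIn Set.univ F

/-- A maximal flag of core subgraphs of `Γ`. -/
def IsMaximalCoreFlag (F : Set (Set G.E)) : Prop := G.IsMaximalCoreFlagIn Set.univ F

end Multigraph

namespace Multigraph

theorem connSetoid_le_of_step (G : Multigraph) {μ : Set G.E} {s : Setoid G.V}
    (h : ∀ e ∈ μ, ∀ x y, G.ends e = s(x, y) → s x y) : G.connSetoid μ ≤ s :=
  Setoid.eqvGen_le fun x y ⟨e, he, hs⟩ => h e he x y hs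

theorem connSetoid_of_ends (G : Multigraph) {μ : Set G.E} {e : G.E} (he : e ∈ μ) {v w : G.V}
    (hs : G.ends e = s(v, w)) : G.connSetoid μ v w :=
  Relation.EqvGen.rel _ _ ⟨e, he, hs⟩

theorem connSetoid_mono (G : Multigraph) {μ ν : Set G.E} (h : μ ⊆ ν) :
    G.connSetoid μ ≤ G.connSetoid ν :=
  G.connSetoid_le_of_step fun _ he _ _ hs => G.connSetoid_of_ends (h he) hs

/-- Two vertices outside the `μ`-component of `w` that are connected after adding an edge
at `w` are already connected by `μ`. -/
theorem rel_of_rel_insert (G : Multigraph) {μ : Set G.E} {e : G.E} {v w : G.V}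
    (hs : G.ends e = s(v, w)) {x y : G.V} (hxy : G.connSetoid (insert e μ) x y)
    (hx : ¬ G.connSetoid μ x w) (hy : ¬ G.connSetoid μ y w) : G.connSetoid μ x y := by
  let g : G.V → Quotient (G.connSetoid μ) := fun z =>
    if G.connSetoid μ z w then Quotient.mk _ v else Quotient.mk _ z
  have hg : G.connSetoid (insert e μ) ≤ Setoid.ker g := by
    have key : g v = g w := by
      have : G.connSetoid μ w w := (G.connSetoid μ).refl w
      simp only [g, this, if_true, ite_self]
    refine G.connSetoid_le_of_step ?_
    rintro f (rfl | hf) p q hpq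
    · rw [hs, Sym2.eq_iff] at hpq
      rcases hpq with ⟨rfl, rfl⟩ | ⟨rfl, rfl⟩
      · exact key
      · exact key.symm
    · have hr := G.connSetoid_of_ends hf hpq
      have hiff : G.connSetoid μ p w ↔ G.connSetoid μ q w :=
        ⟨fun h => (G.connSetoid μ).trans ((G.connSetoid μ).symm hr) h,
          fun h => (G.connSetoid μ).trans hr h⟩
      have hmk : (Quotient.mk (G.connSetoid μ) p) = Quotient.mk _ q := Quotient.sound hr
      change g p = g q
      simp only [g, hiff, hmk]
  have h : g x = g y := hg hxy
  simp only [g, hx, hy, if_false] at h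
  exact Quotient.exact h

theorem h0_le_h0_insert_add_one (G : Multigraph) (μ : Set G.E) (e : G.E) :
    G.h0 μ ≤ G.h0 (insert e μ) + 1 := by
  obtain ⟨⟨v, w⟩, hs⟩ := Quot.exists_rep (G.ends e)
  replace hs : G.ends e = s(v, w) := hs.symm
  let f : Quotient (G.connSetoid μ) → Option (Quotient (G.connSetoid (insert e μ))) := fun c =>
    if c = Quotient.mk _ w then none
    else some (Quotient.map' id
      (fun _ _ h => G.connSetoid_mono (Set.subset_insert e μ) h) c)
  have hf : Function.Injective f := by
    intro c d
    induction c using Quotient.inductionOn with | _ x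
    induction d using Quotient.inductionOn with | _ y
    intro h
    by_cases hx : (Quotient.mk (G.connSetoid μ) x) = Quotient.mk _ w <;>
      by_cases hy : (Quotient.mk (G.connSetoid μ) y) = Quotient.mk _ w
    · rw [hx, hy]
    · simp [f, hx, hy] at h
    · simp [f, hx, hy] at h
    · simp only [f, hx, hy, if_false, Option.some.injEq] at h
      exact Quotient.sound (G.rel_of_rel_insert hs (Quotient.exact h)
        (fun h => hx (Quotient.sound h)) (fun h => hy (Quotient.sound h)))
  have := Nat.card_le_card_of_injective f hf
  rwa [Finite.card_option] at this

theorem h0_insert_lt (G : Multigraph) {μ : Set G.E} {e : G.E} {v w : G.V}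
    (hs : G.ends e = s(v, w)) (hvw : ¬ G.connSetoid μ v w) :
    G.h0 (insert e μ) < G.h0 μ := by
  let f : Quotient (G.connSetoid μ) → Quotient (G.connSetoid (insert e μ)) :=
    Quotient.map' id (fun _ _ h => G.connSetoid_mono (Set.subset_insert e μ) h)
  have hsurj : Function.Surjective f := fun c => by
    induction c using Quotient.inductionOn with | _ x
    exact ⟨Quotient.mk _ x, rfl⟩
  refine lt_of_le_of_ne (Nat.card_le_card_of_surjective f hsurj) fun hcard => hvw ?_
  have hinj := (Function.Surjective.bijective_of_nat_card_le hsurj hcard.ge).injective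
  exact Quotient.exact (@hinj (Quotient.mk _ v) (Quotient.mk _ w)
    (Quotient.sound (G.connSetoid_of_ends (Set.mem_insert e μ) hs)))

theorem card_insert (G : Multigraph) {μ : Set G.E} {e : G.E} (he : e ∉ μ) :
    Nat.card (insert e μ : Set G.E) = Nat.card μ + 1 :=
  Set.ncard_insert_of_notMem he

theorem h1_le_h1_insert (G : Multigraph) (μ : Set G.E) (e : G.E) :
    G.h1 μ ≤ G.h1 (insert e μ) := by
  by_cases he : e ∈ μ
  · rw [Set.insert_eq_of_mem he]
  · have h := G.h0_le_h0_insert_add_one μ e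
    have hc := G.card_insert he
    unfold h1
    omega

theorem h1_mono (G : Multigraph) {μ ν : Set G.E} (h : μ ⊆ ν) : G.h1 μ ≤ G.h1 ν := by
  have key : ∀ s : Set G.E, G.h1 μ ≤ G.h1 (μ ∪ s) := fun s => by
    induction s, s.toFinite using Set.Finite.induction_on with
    | empty => simp
    | @insert e s _ _ ih =>
      rw [Set.union_insert]
      exact ih.trans (G.h1_le_h1_insert _ e)
  simpa [Set.union_eq_self_of_subset_left h] using key ν

theorem h1_empty (G : Multigraph) : G.h1 ∅ = 0 := by
  have hbot : G.connSetoid ∅ = ⊥ :=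
    le_bot_iff.mp (G.connSetoid_le_of_step fun e he => absurd he (Set.notMem_empty e))
  have h0 : G.h0 ∅ = Nat.card G.V := by
    unfold Multigraph.h0
    rw [hbot]
    exact (Nat.card_congr (Equiv.ofBijective (Quotient.mk (⊥ : Setoid G.V))
      ⟨fun _ _ h => Quotient.exact h, Quotient.mk_surjective⟩)).symm
  simp [h1, h0]

theorem h1_nonneg (G : Multigraph) (μ : Set G.E) : 0 ≤ G.h1 μ :=
  G.h1_empty ▸ G.h1_mono (Set.empty_subset μ)

/-- Every acyclic edge set extends to a spanning forest. -/
theorem exists_isSpanningForest_superset (G : Multigraph) {μ : Set G.E} (hμ : G.h1 μ = 0) :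
    ∃ F, μ ⊆ F ∧ G.IsSpanningForest F := by
  obtain ⟨F, hμF, hF⟩ :=
    (Set.toFinite {F : Set G.E | G.h1 F = 0}).exists_le_maximal (Set.mem_ofPred.mpr hμ)
  have hF0 : G.h1 F = 0 := hF.prop
  refine ⟨F, hμF, hF0, le_antisymm (G.connSetoid_mono (Set.subset_univ F))
    (G.connSetoid_le_of_step fun e _ v w hs => ?_)⟩
  by_contra hvw
  have he : e ∉ F := fun he => hvw (G.connSetoid_of_ends he hs)
  have hlt := G.h0_insert_lt hs hvw
  have hc := G.card_insert he
  have hnonneg := G.h1_nonneg (insert e F)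
  have hins : G.h1 (insert e F) = 0 := by
    unfold h1 at *
    omega
  exact he (hF.le_of_ge hins (Set.subset_insert e F) (Set.mem_insert e F))

theorem aeval_kirchhoff (G : Multigraph) (a : G.E → ℝ) :
    MvPolynomial.aeval a G.kirchhoff =
      ∑ F ∈ (Set.toFinite {F : Set G.E | G.IsSpanningForest F}).toFinset,
        ∏ e ∈ (Set.toFinite Fᶜ).toFinset, a e := by
  unfold kirchhoff
  rw [finsum_mem_eq_finite_toFinset_sum _ (Set.toFinite _), map_sum]
  refine Finset.sum_congr rfl fun F _ => ?_
  rw [finprod_mem_eq_finite_toFinset_prod _ (Set.toFinite _), map_prod]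
  simp only [MvPolynomial.aeval_X]

theorem aeval_kirchhoff_nonneg (G : Multigraph) {a : G.E → ℝ} (ha : ∀ e, 0 ≤ a e) :
    0 ≤ MvPolynomial.aeval a G.kirchhoff := by
  rw [aeval_kirchhoff]
  exact Finset.sum_nonneg fun F _ => Finset.prod_nonneg fun e _ => ha e

theorem aeval_kirchhoff_eq_zero_iff (G : Multigraph) {a : G.E → ℝ} (ha : ∀ e, 0 ≤ a e) :
    MvPolynomial.aeval a G.kirchhoff = 0 ↔ 0 < G.h1 {e : G.E | a e = 0} := by
  rw [aeval_kirchhoff, Finset.sum_eq_zero_iff_of_nonneg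
    fun F _ => Finset.prod_nonneg fun e _ => ha e]
  simp only [Set.Finite.mem_toFinset, Finset.prod_eq_zero_iff, Set.mem_ofPred_eq,
    Set.mem_compl_iff]
  constructor
  · intro h
    refine lt_of_le_of_ne (G.h1_nonneg _) fun h0 => ?_
    obtain ⟨F, hμF, hF⟩ := G.exists_isSpanningForest_superset h0.symm
    obtain ⟨e, heF, he⟩ := h F hF
    exact heF (hμF he)
  · intro h F hF
    by_contra! hne
    have hsub : {e : G.E | a e = 0} ⊆ F := fun e he => by
      by_contra heF
      exact hne e heF he
    exact absurd (G.h1_mono hsub) (by rw [hF.1]; exact not_le.mpr h)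

end Multigraph

/-- for a connected multigraph and nonnegative reals `a_e`, not all
zero, `ψ(Γ)(a) = 0` iff the subgraph on `{e | a_e = 0}` contains a cycle; in
particular `ψ(Γ)(a) > 0` whenever all `a_e > 0`. -/
theorem kirchhoff_eval_nonneg (G : Multigraph) (hG : G.Connected) (a : G.E → ℝ)
    (ha : ∀ e, 0 ≤ a e) (hne : ∃ e, a e ≠ 0) :
    (MvPolynomial.aeval a G.kirchhoff = 0 ↔ 0 < G.h1 {e : G.E | a e = 0}) ∧
      ((∀ e, 0 < a e) → 0 < MvPolynomial.aeval a G.kirchhoff) := by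
  refine ⟨G.aeval_kirchhoff_eq_zero_iff ha, fun hpos => ?_⟩
  refine lt_of_le_of_ne (G.aeval_kirchhoff_nonneg ha) fun h => ?_
  have hempty : {e : G.E | a e = 0} = ∅ := Set.eq_empty_of_forall_notMem fun e => (hpos e).ne'
  have := (G.aeval_kirchhoff_eq_zero_iff ha).mp h.symm
  rw [hempty, G.h1_empty] at this
  exact lt_irrefl 0 this
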